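/- Let n₁, n₂ ≥ 1 be integers, set k₁ = 2πn₁, k₂ = 2πn₂, and let v : ℝ² → ℝ² be v(x,y) = (sin(k₁x) sin(k₂y), sin(k₁x) sin(k₂y)). Let Γ : ℝ² → ℝ² be a smooth ℤ²-periodic map satisfying Γ − ΔΓ = −½[(∇v)ᵀe₂ + (∇·v)e₂] on ℝ². Then ∫_{[0,1]²} Γ·(Γ − ΔΓ) d(x,y) = (1/8)·(2k₂² + k₁²)/(1 + k₁² + k₂²); in particular this quantity is strictly positive. (This integral equals the sectional curvature S(e₂, v) = ⟨Γ(e₂,v), Γ(e₂,v)⟩ of the right-invariant H¹ metric associated with the 2D Camassa–Holm equation, so S is positive on span{e₂, v}.) -/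

import Mathlib

open MeasureTheory Real

noncomputable section

/-- Euclidean dot product on `ℝ × ℝ`. -/
def dot2 (a b : ℝ × ℝ) : ℝ := a.1 * b.1 + a.2 * b.2

/-- The Jacobian matrix of `f` at `z` applied to the vector `v`, i.e. `∇f·v`. -/
def jac (f : ℝ × ℝ → ℝ × ℝ) (z v : ℝ × ℝ) : ℝ × ℝ := fderiv ℝ f z v

/-- The transposed Jacobian of `f` at `z` applied to `m`, i.e. `(∇f)ᵀ m`. -/
def jacT (f : ℝ × ℝ → ℝ × ℝ) (z m : ℝ × ℝ) : ℝ × ℝ :=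
  (dot2 (fderiv ℝ f z (1, 0)) m, dot2 (fderiv ℝ f z (0, 1)) m)

/-- The divergence `∇·f`. -/
def div2 (f : ℝ × ℝ → ℝ × ℝ) (z : ℝ × ℝ) : ℝ :=
  (fderiv ℝ f z (1, 0)).1 + (fderiv ℝ f z (0, 1)).2

/-- The componentwise Laplacian `Δf = ∂ₓ²f + ∂ᵧ²f`. -/
def lap2 (f : ℝ × ℝ → ℝ × ℝ) (z : ℝ × ℝ) : ℝ × ℝ :=
  fderiv ℝ (fun w => fderiv ℝ f w (1, 0)) z (1, 0) +
  fderiv ℝ (fun w => fderiv ℝ f w (0, 1)) z (0, 1)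

/-- The Laplacian of a scalar function on `ℝ²`. -/
def lapS (f : ℝ × ℝ → ℝ) (z : ℝ × ℝ) : ℝ :=
  fderiv ℝ (fun w => fderiv ℝ f w (1, 0)) z (1, 0) +
  fderiv ℝ (fun w => fderiv ℝ f w (0, 1)) z (0, 1)

/-- A map on `ℝ²` is `ℤ²`-periodic (i.e. descends to the torus `𝕋 = (ℝ/ℤ)²`). -/
def Periodic2 {α : Type*} (f : ℝ × ℝ → α) : Prop :=
  ∀ (z : ℝ × ℝ) (n : ℤ × ℤ), f (z + ((n.1 : ℝ), (n.2 : ℝ))) = f z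

/-- The fundamental domain `[0,1]²` of the torus. -/
def sq01 : Set (ℝ × ℝ) := Set.Icc (0, 0) (1, 1)

/-- Along any direction, the second derivative at a global maximum is nonpositive. -/
theorem fderiv_fderiv_apply_nonpos_of_forall_le {h : ℝ × ℝ → ℝ} (hh : ContDiff ℝ 2 h)
    {z : ℝ × ℝ} (hz : ∀ w, h w ≤ h z) (e : ℝ × ℝ) :
    fderiv ℝ (fun w => fderiv ℝ h w e) z e ≤ 0 := by
  have hline : ∀ t : ℝ, HasDerivAt (fun t : ℝ => z + t • e) e t := fun t => by
    simpa using ((hasDerivAt_id t).smul_const e).const_add z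
  have hderiv : deriv (fun t : ℝ => h (z + t • e)) = fun t => fderiv ℝ h (z + t • e) e := by
    funext t
    exact (((hh.differentiable (by norm_num)) _).hasFDerivAt.comp_hasDerivAt t (hline t)).deriv
  have hd : Differentiable ℝ (fun w => fderiv ℝ h w e) :=
    ((hh.fderiv_right (m := 1) (by norm_num)).clm_apply contDiff_const).differentiable
      (by norm_num)
  have hderiv2 : deriv (deriv (fun t : ℝ => h (z + t • e))) 0
      = fderiv ℝ (fun w => fderiv ℝ h w e) z e := by
    rw [hderiv]
    refine ((hd _).hasFDerivAt.comp_hasDerivAt (0 : ℝ) (hline 0)).deriv.trans ?_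
    simp
  by_contra! hpos
  rw [← hderiv2] at hpos
  have hmax : IsLocalMax (fun t : ℝ => h (z + t • e)) 0 :=
    Filter.Eventually.of_forall fun t => by simpa using hz (z + t • e)
  have hcont : ContinuousAt (fun t : ℝ => h (z + t • e)) 0 :=
    (hh.continuous.comp (by fun_prop)).continuousAt
  have hmin := isLocalMin_of_deriv_deriv_pos hpos hmax.deriv_eq_zero hcont
  have hconst : (fun t : ℝ => h (z + t • e)) =ᶠ[nhds 0] fun _ => h z := by
    filter_upwards [hmax, hmin] with t h1 h2
    simp only [zero_smul, add_zero] at h1 h2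
    exact le_antisymm h1 h2
  rw [hconst.deriv.deriv_eq] at hpos
  simp at hpos

/-- A continuous `ℤ²`-periodic function attains its maximum. -/
theorem Periodic2.exists_forall_le {h : ℝ × ℝ → ℝ} (hp : Periodic2 h) (hc : Continuous h) :
    ∃ z, ∀ w, h w ≤ h z := by
  obtain ⟨z, -, hz⟩ := (isCompact_Icc (a := ((0 : ℝ), (0 : ℝ))) (b := (1, 1))).exists_isMaxOn
    ⟨(0, 0), by simp⟩ hc.continuousOn
  refine ⟨z, fun w => ?_⟩
  rw [← hp w (-⌊w.1⌋, -⌊w.2⌋)]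
  refine hz ?_
  rw [Set.mem_Icc, Prod.le_def, Prod.le_def]
  have h1 := Int.floor_le w.1
  have h2 := Int.floor_le w.2
  have h3 := (Int.lt_floor_add_one w.1).le
  have h4 := (Int.lt_floor_add_one w.2).le
  refine ⟨⟨?_, ?_⟩, ?_, ?_⟩ <;> simp <;> linarith

/-- Maximum principle: a periodic solution of `h = Δh` is nonpositive. -/
theorem Periodic2.nonpos_of_eq_lapS {h : ℝ × ℝ → ℝ} (hp : Periodic2 h) (hh : ContDiff ℝ 2 h)
    (heq : ∀ z, h z = lapS h z) (w : ℝ × ℝ) : h w ≤ 0 := by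
  obtain ⟨z, hz⟩ := hp.exists_forall_le hh.continuous
  refine (hz w).trans ?_
  rw [heq z, lapS]
  exact add_nonpos (fderiv_fderiv_apply_nonpos_of_forall_le hh hz _)
    (fderiv_fderiv_apply_nonpos_of_forall_le hh hz _)

theorem lapS_sub {f g : ℝ × ℝ → ℝ} (hf : ContDiff ℝ 2 f) (hg : ContDiff ℝ 2 g) (z : ℝ × ℝ) :
    lapS (fun w => f w - g w) z = lapS f z - lapS g z := by
  have hd : ∀ {f : ℝ × ℝ → ℝ}, ContDiff ℝ 2 f → ∀ e,
      Differentiable ℝ (fun w => fderiv ℝ f w e) := fun hf e =>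
    ((hf.fderiv_right (m := 1) (by norm_num)).clm_apply contDiff_const).differentiable
      (by norm_num)
  have h1 : ∀ e, (fun w => fderiv ℝ (fun w => f w - g w) w e)
      = fun w => fderiv ℝ f w e - fderiv ℝ g w e := fun e => by
    funext w
    rw [fderiv_fun_sub ((hf.differentiable (by norm_num)) w)
      ((hg.differentiable (by norm_num)) w)]
    simp
  simp only [lapS, h1]
  rw [fderiv_fun_sub (hd hf _ z) (hd hg _ z), fderiv_fun_sub (hd hf _ z) (hd hg _ z)]
  simp only [sub_apply]
  ring

/-- Periodic solutions of `f - Δf = F` are unique. -/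
theorem Periodic2.eq_of_sub_lapS_eq {f g : ℝ × ℝ → ℝ} (hfp : Periodic2 f) (hgp : Periodic2 g)
    (hf : ContDiff ℝ 2 f) (hg : ContDiff ℝ 2 g)
    (h : ∀ z, f z - lapS f z = g z - lapS g z) : f = g := by
  funext w
  have h1 := Periodic2.nonpos_of_eq_lapS (h := fun w => f w - g w)
    (fun z n => by simp only [hfp z n, hgp z n]) (hf.sub hg)
    (fun z => by rw [lapS_sub hf hg]; linarith [h z]) w
  have h2 := Periodic2.nonpos_of_eq_lapS (h := fun w => g w - f w)
    (fun z n => by simp only [hfp z n, hgp z n]) (hg.sub hf)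
    (fun z => by rw [lapS_sub hg hf]; linarith [h z]) w
  linarith

theorem lap2_fst {f : ℝ × ℝ → ℝ × ℝ} (hf : ContDiff ℝ 2 f) (z : ℝ × ℝ) :
    (lap2 f z).1 = lapS (fun w => (f w).1) z := by
  have hd : ∀ e, Differentiable ℝ (fun w => fderiv ℝ f w e) := fun e =>
    ((hf.fderiv_right (m := 1) (by norm_num)).clm_apply contDiff_const).differentiable
      (by norm_num)
  have h1 : ∀ e, (fun w => fderiv ℝ (fun w => (f w).1) w e) = fun w => (fderiv ℝ f w e).1 :=
    fun e => by
      funext w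
      rw [((hf.differentiable (by norm_num)) w).hasFDerivAt.fst.fderiv]
      rfl
  simp only [lapS, h1, lap2]
  rw [(hd _ z).hasFDerivAt.fst.fderiv, (hd _ z).hasFDerivAt.fst.fderiv]
  rfl

theorem lap2_snd {f : ℝ × ℝ → ℝ × ℝ} (hf : ContDiff ℝ 2 f) (z : ℝ × ℝ) :
    (lap2 f z).2 = lapS (fun w => (f w).2) z := by
  have hd : ∀ e, Differentiable ℝ (fun w => fderiv ℝ f w e) := fun e =>
    ((hf.fderiv_right (m := 1) (by norm_num)).clm_apply contDiff_const).differentiable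
      (by norm_num)
  have h1 : ∀ e, (fun w => fderiv ℝ (fun w => (f w).2) w e) = fun w => (fderiv ℝ f w e).2 :=
    fun e => by
      funext w
      rw [((hf.differentiable (by norm_num)) w).hasFDerivAt.snd.fderiv]
      rfl
  simp only [lapS, h1, lap2]
  rw [(hd _ z).hasFDerivAt.snd.fderiv, (hd _ z).hasFDerivAt.snd.fderiv]
  rfl

theorem fderiv_sin_mul_sin (k l : ℝ) (z e : ℝ × ℝ) :
    fderiv ℝ (fun w : ℝ × ℝ => (sin (k * w.1) * sin (l * w.2), sin (k * w.1) * sin (l * w.2))) z e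
      = (k * cos (k * z.1) * sin (l * z.2) * e.1 + l * sin (k * z.1) * cos (l * z.2) * e.2,
         k * cos (k * z.1) * sin (l * z.2) * e.1 + l * sin (k * z.1) * cos (l * z.2) * e.2) := by
  have h := ((hasFDerivAt_fst (𝕜 := ℝ) (p := z)).const_mul k).sin.mul
    ((hasFDerivAt_snd (𝕜 := ℝ) (p := z)).const_mul l).sin
  have h2 := (h.prodMk h).fderiv
  refine (congrArg (fun L : ℝ × ℝ →L[ℝ] ℝ × ℝ => L e) h2).trans ?_
  ext <;> simp <;> ring

/-- The combinations of `cos (kx) sin (ly)` and `sin (kx) cos (ly)` are eigenfunctions of `Δ`. -/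
theorem lapS_cos_sin_add_sin_cos (a b k l : ℝ) (z : ℝ × ℝ) :
    lapS (fun w => a * (cos (k * w.1) * sin (l * w.2)) + b * (sin (k * w.1) * cos (l * w.2))) z
      = -(k ^ 2 + l ^ 2) *
        (a * (cos (k * z.1) * sin (l * z.2)) + b * (sin (k * z.1) * cos (l * z.2))) := by
  have hx : ∀ w : ℝ × ℝ, HasFDerivAt (fun w : ℝ × ℝ => k * w.1)
      (k • ContinuousLinearMap.fst ℝ ℝ ℝ) w := fun w => hasFDerivAt_fst.const_mul k
  have hy : ∀ w : ℝ × ℝ, HasFDerivAt (fun w : ℝ × ℝ => l * w.2)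
      (l • ContinuousLinearMap.snd ℝ ℝ ℝ) w := fun w => hasFDerivAt_snd.const_mul l
  have h1 : ∀ e : ℝ × ℝ, (fun w : ℝ × ℝ => fderiv ℝ (fun w : ℝ × ℝ =>
      a * (cos (k * w.1) * sin (l * w.2)) + b * (sin (k * w.1) * cos (l * w.2))) w e)
      = fun w => (-(a * k * e.1) - b * l * e.2) * (sin (k * w.1) * sin (l * w.2))
        + (a * l * e.2 + b * k * e.1) * (cos (k * w.1) * cos (l * w.2)) := fun e => by
    funext w
    have h := (((hx w).cos.mul (hy w).sin).const_mul a).add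
      (((hx w).sin.mul (hy w).cos).const_mul b)
    refine (congrArg (fun L : ℝ × ℝ →L[ℝ] ℝ => L e) h.fderiv).trans ?_
    simp
    ring
  have h2 : ∀ (c d : ℝ) (e : ℝ × ℝ), fderiv ℝ (fun w : ℝ × ℝ =>
      c * (sin (k * w.1) * sin (l * w.2)) + d * (cos (k * w.1) * cos (l * w.2))) z e
      = (c * k * e.1 - d * l * e.2) * (cos (k * z.1) * sin (l * z.2))
        + (c * l * e.2 - d * k * e.1) * (sin (k * z.1) * cos (l * z.2)) := fun c d e => by
    have h := (((hx z).sin.mul (hy z).sin).const_mul c).add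
      (((hx z).cos.mul (hy z).cos).const_mul d)
    refine (congrArg (fun L : ℝ × ℝ →L[ℝ] ℝ => L e) h.fderiv).trans ?_
    simp
    ring
  simp only [lapS, h1, h2]
  ring

theorem periodic2_cos_sin_add_sin_cos (a b : ℝ) (n₁ n₂ : ℕ) :
    Periodic2 (fun w : ℝ × ℝ =>
      a * (cos (2 * π * n₁ * w.1) * sin (2 * π * n₂ * w.2))
        + b * (sin (2 * π * n₁ * w.1) * cos (2 * π * n₂ * w.2))) := by
  intro z n
  have h : ∀ (m : ℕ) (x : ℝ) (j : ℤ),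
      2 * π * m * (x + j) = 2 * π * m * x + ((m * j : ℤ) : ℝ) * (2 * π) := fun m x j => by
    push_cast; ring
  simp only [Prod.fst_add, Prod.snd_add, h, cos_add_int_mul_two_pi, sin_add_int_mul_two_pi]

theorem integral_cos_two_mul_eq_zero {n : ℕ} (hn : 1 ≤ n) :
    ∫ x in (0 : ℝ)..1, cos (2 * (2 * π * n * x)) = 0 := by
  have hn' : (0 : ℝ) < n := by exact_mod_cast hn
  have hk : (2 * (2 * π * n)) ≠ 0 := by positivity
  have h : ∀ x : ℝ, 2 * (2 * π * n * x) = (2 * (2 * π * n)) * x := fun x => by ring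
  simp only [h]
  rw [intervalIntegral.integral_comp_mul_left (fun x => cos x) hk, integral_cos]
  have : 2 * (2 * π * n) * 1 = ((4 * n : ℕ) : ℝ) * π := by push_cast; ring
  rw [this, sin_nat_mul_pi]
  simp

theorem setIntegral_cos_sq {n : ℕ} (hn : 1 ≤ n) :
    ∫ x in Set.Icc (0 : ℝ) 1, cos (2 * π * n * x) ^ 2 = 1 / 2 := by
  rw [integral_Icc_eq_integral_Ioc, ← intervalIntegral.integral_of_le zero_le_one]
  simp only [cos_sq]
  rw [intervalIntegral.integral_add (Continuous.intervalIntegrable (by fun_prop) _ _)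
    (Continuous.intervalIntegrable (by fun_prop) _ _), intervalIntegral.integral_div,
    intervalIntegral.integral_div, integral_cos_two_mul_eq_zero hn]
  simp

theorem setIntegral_sin_sq {n : ℕ} (hn : 1 ≤ n) :
    ∫ x in Set.Icc (0 : ℝ) 1, sin (2 * π * n * x) ^ 2 = 1 / 2 := by
  rw [integral_Icc_eq_integral_Ioc, ← intervalIntegral.integral_of_le zero_le_one]
  simp only [sin_sq_eq_half_sub]
  rw [intervalIntegral.integral_sub (Continuous.intervalIntegrable (by fun_prop) _ _)
    (Continuous.intervalIntegrable (by fun_prop) _ _), intervalIntegral.integral_div,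
    intervalIntegral.integral_div, integral_cos_two_mul_eq_zero hn]
  simp

theorem setIntegral_sin_mul_cos {n : ℕ} (hn : 1 ≤ n) :
    ∫ x in Set.Icc (0 : ℝ) 1, sin (2 * π * n * x) * cos (2 * π * n * x) = 0 := by
  have hn' : (0 : ℝ) < n := by exact_mod_cast hn
  have hk : 2 * π * n ≠ 0 := by positivity
  rw [integral_Icc_eq_integral_Ioc, ← intervalIntegral.integral_of_le zero_le_one,
    intervalIntegral.integral_comp_mul_left (fun x => sin x * cos x) hk, integral_sin_mul_cos₁]
  have : 2 * π * n * 1 = ((2 * n : ℕ) : ℝ) * π := by push_cast; ring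
  rw [this, sin_nat_mul_pi]
  simp

theorem sq01_eq_prod : sq01 = Set.Icc (0 : ℝ) 1 ×ˢ Set.Icc (0 : ℝ) 1 :=
  (Set.Icc_prod_Icc _ _ _ _).symm

theorem setIntegral_sq01_mul (f g : ℝ → ℝ) :
    ∫ z in sq01, f z.1 * g z.2 = (∫ x in Set.Icc (0 : ℝ) 1, f x) * ∫ y in Set.Icc (0 : ℝ) 1, g y := by
  rw [sq01_eq_prod]
  exact setIntegral_prod_mul f g _ _

theorem setIntegral_sq01_quadratic {n₁ n₂ : ℕ} (hn₁ : 1 ≤ n₁) (hn₂ : 1 ≤ n₂) (a b c : ℝ) :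
    ∫ z in sq01, (a * (cos (2 * π * n₁ * z.1) ^ 2 * sin (2 * π * n₂ * z.2) ^ 2)
      + b * (sin (2 * π * n₁ * z.1) ^ 2 * cos (2 * π * n₂ * z.2) ^ 2)
      + c * ((sin (2 * π * n₁ * z.1) * cos (2 * π * n₁ * z.1))
        * (sin (2 * π * n₂ * z.2) * cos (2 * π * n₂ * z.2)))) = (a + b) / 4 := by
  have hi : ∀ {f : ℝ × ℝ → ℝ}, Continuous f → Integrable f (volume.restrict sq01) :=
    fun hf => hf.continuousOn.integrableOn_compact isCompact_Icc
  rw [integral_add (hi (by fun_prop)) (hi (by fun_prop)),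
    integral_add (hi (by fun_prop)) (hi (by fun_prop)), integral_const_mul, integral_const_mul,
    integral_const_mul,
    setIntegral_sq01_mul (fun x => cos (2 * π * n₁ * x) ^ 2) (fun y => sin (2 * π * n₂ * y) ^ 2),
    setIntegral_sq01_mul (fun x => sin (2 * π * n₁ * x) ^ 2) (fun y => cos (2 * π * n₂ * y) ^ 2),
    setIntegral_sq01_mul (fun x => sin (2 * π * n₁ * x) * cos (2 * π * n₁ * x))
      (fun y => sin (2 * π * n₂ * y) * cos (2 * π * n₂ * y)),
    setIntegral_cos_sq hn₁, setIntegral_cos_sq hn₂, setIntegral_sin_sq hn₁,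
    setIntegral_sin_sq hn₂, setIntegral_sin_mul_cos hn₁]
  ring

/-- explicit value and positivity of the sectional curvature
`S(eᵢ, v) = ⟨Γ(eᵢ,v), Γ(eᵢ,v)⟩` of the right-invariant H¹ metric of the 2D
Camassa–Holm equation, for `v = (sin(k₁x)sin(k₂y), sin(k₁x)sin(k₂y))`. -/
theorem sectional_curvature_positive_8 (n₁ n₂ : ℕ) (hn₁ : 1 ≤ n₁) (hn₂ : 1 ≤ n₂)
    (k₁ k₂ : ℝ) (hk₁ : k₁ = 2 * Real.pi * n₁) (hk₂ : k₂ = 2 * Real.pi * n₂)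
    (v : ℝ × ℝ → ℝ × ℝ)
    (hv : v = fun z => (Real.sin (k₁ * z.1) * Real.sin (k₂ * z.2),
                        Real.sin (k₁ * z.1) * Real.sin (k₂ * z.2)))
    (Γ : ℝ × ℝ → ℝ × ℝ) (hΓ : ContDiff ℝ (⊤ : ℕ∞) Γ) (hΓp : Periodic2 Γ)
    (hΓeq : ∀ z : ℝ × ℝ, Γ z - lap2 Γ z
      = -(1 / 2 : ℝ) • (jacT v z ((0 : ℝ), (1 : ℝ)) + div2 v z • (((0 : ℝ), (1 : ℝ)) : ℝ × ℝ))) :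
    (∫ z in sq01, dot2 (Γ z) (Γ z - lap2 Γ z))
        = (1 / 8) * (2 * k₂ ^ 2 + k₁ ^ 2) / (1 + k₁ ^ 2 + k₂ ^ 2) ∧
    0 < ∫ z in sq01, dot2 (Γ z) (Γ z - lap2 Γ z) := by
  have hn₁' : (0 : ℝ) < n₁ := by exact_mod_cast hn₁
  have hk₁pos : 0 < k₁ := by rw [hk₁]; positivity
  have hden : 1 + k₁ ^ 2 + k₂ ^ 2 ≠ 0 := by positivity
  have hΓ2 : ContDiff ℝ 2 Γ := contDiff_infty.1 hΓ 2
  have hrhs : ∀ z, Γ z - lap2 Γ z =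
      (-(k₁ / 2) * (cos (k₁ * z.1) * sin (k₂ * z.2)) + 0 * (sin (k₁ * z.1) * cos (k₂ * z.2)),
       -(k₁ / 2) * (cos (k₁ * z.1) * sin (k₂ * z.2))
        + -k₂ * (sin (k₁ * z.1) * cos (k₂ * z.2))) := fun z => by
    rw [hΓeq z, hv]
    simp only [jacT, div2, dot2, fderiv_sin_mul_sin]
    ext <;> simp <;> ring
  have hsolve : ∀ (f : ℝ × ℝ → ℝ) (a b : ℝ), Periodic2 f → ContDiff ℝ 2 f →
      (∀ z, f z - lapS f z =
        a * (cos (k₁ * z.1) * sin (k₂ * z.2)) + b * (sin (k₁ * z.1) * cos (k₂ * z.2))) →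
      ∀ z, f z = (a * (cos (k₁ * z.1) * sin (k₂ * z.2))
        + b * (sin (k₁ * z.1) * cos (k₂ * z.2))) / (1 + k₁ ^ 2 + k₂ ^ 2) := by
    intro f a b hp hf h z
    have hg := hp.eq_of_sub_lapS_eq
      (g := fun w => a / (1 + k₁ ^ 2 + k₂ ^ 2) * (cos (k₁ * w.1) * sin (k₂ * w.2))
        + b / (1 + k₁ ^ 2 + k₂ ^ 2) * (sin (k₁ * w.1) * cos (k₂ * w.2)))
      (by rw [hk₁, hk₂]; exact periodic2_cos_sin_add_sin_cos _ _ n₁ n₂) hf (by fun_prop)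
      (fun w => by
        rw [h w, lapS_cos_sin_add_sin_cos]
        field_simp
        ring)
    rw [hg]
    ring
  have hfst := hsolve (fun w => (Γ w).1) _ _ (fun z n => by simp only [hΓp z n]) hΓ2.fst
    (fun z => by
      rw [← lap2_fst hΓ2]
      exact congrArg Prod.fst (hrhs z))
  have hsnd := hsolve (fun w => (Γ w).2) _ _ (fun z n => by simp only [hΓp z n]) hΓ2.snd
    (fun z => by
      rw [← lap2_snd hΓ2]
      exact congrArg Prod.snd (hrhs z))
  have hint : (∫ z in sq01, dot2 (Γ z) (Γ z - lap2 Γ z))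
      = (1 / 8) * (2 * k₂ ^ 2 + k₁ ^ 2) / (1 + k₁ ^ 2 + k₂ ^ 2) := by
    have hquad := setIntegral_sq01_quadratic hn₁ hn₂
      (k₁ ^ 2 / 2 / (1 + k₁ ^ 2 + k₂ ^ 2)) (k₂ ^ 2 / (1 + k₁ ^ 2 + k₂ ^ 2))
      (k₁ * k₂ / (1 + k₁ ^ 2 + k₂ ^ 2))
    rw [← hk₁, ← hk₂] at hquad
    have hpt : ∀ z, dot2 (Γ z) (Γ z - lap2 Γ z) = _ := fun z => by
      rw [hrhs z, dot2, hfst z, hsnd z]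
    simp only [hpt]
    refine Eq.trans (integral_congr_ae (Filter.Eventually.of_forall fun z => ?_))
      (hquad.trans ?_)
    · dsimp only
      ring
    · ring
  refine ⟨hint, ?_⟩
  rw [hint]
  positivity
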